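/- arXiv:1307.6333 — 2 statements merged into one kernel-verified Lean document; each statement's English description precedes it below -/
import Mathlib

section
/- If 𝒯 is an acceptable labelled tree for ψ and E, then the protocol P derived from 𝒯 (assigning to each v ∈ 𝒪⁺ the action component P(v) of the label 𝒯(v)) realizes ψ in E. -/
/-! Single-agent framework: formulas of the logic of knowledge and branching time,
finite interpreted environments, runs, protocols, generated interpreted systems,
satisfaction, realizability, labelled trees and acceptability. -/

/-- Formulae of the logic of knowledge and (branching/linear) time for a single agent:
atomic propositions, ¬, ∧, ○ (next), U (until), ∃ (branching quantifier), K₁. -/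
inductive Fml (PP : Type) : Type
  | tru : Fml PP
  | atom : PP → Fml PP
  | neg : Fml PP → Fml PP
  | conj : Fml PP → Fml PP → Fml PP
  | next : Fml PP → Fml PP
  | untl : Fml PP → Fml PP → Fml PP
  | exis : Fml PP → Fml PP
  | know : Fml PP → Fml PP

namespace Fml
variable {PP : Type}

/-- The list of subformulae of a formula. -/
def subf : Fml PP → List (Fml PP)
  | tru => [tru]
  | atom p => [atom p]
  | neg φ => neg φ :: φ.subf
  | conj φ ψ => conj φ ψ :: (φ.subf ++ ψ.subf)
  | next φ => next φ :: φ.subf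
  | untl φ ψ => untl φ ψ :: (φ.subf ++ ψ.subf)
  | exis φ => exis φ :: φ.subf
  | know φ => know φ :: φ.subf

/-- The size of a formula. -/
def size : Fml PP → ℕ
  | tru => 1
  | atom _ => 1
  | neg φ => φ.size + 1
  | conj φ ψ => φ.size + ψ.size + 1
  | next φ => φ.size + 1
  | untl φ ψ => φ.size + ψ.size + 1
  | exis φ => φ.size + 1
  | know φ => φ.size + 1

end Fml

/-- A (finite, when the state type is finite) interpreted environment for a single agent:
initial states, protocol of the environment (nonempty sets of environment actions),
transition function indexed by joint actions, observation function, interpretation. -/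
structure Env (S ACTe ACT1 O PP : Type) where
  initSt : Set S
  Pe : S → Set ACTe
  Pe_ne : ∀ s, (Pe s).Nonempty
  tr : ACTe × ACT1 → S → S
  obs : S → O
  val : S → PP → Bool

namespace Env
variable {S ACTe ACT1 O PP : Type}

/-- Synchronous perfect-recall local state `r₁(m) = O₁(r 0) … O₁(r m)`. -/
def locSt (E : Env S ACTe ACT1 O PP) (r : ℕ → S) (m : ℕ) : List O :=
  (List.range (m + 1)).map fun k => E.obs (r k)

/-- The runs of the interpreted system ℐ(P,E) generated by protocol `P` in `E`:
every transition is by a joint action allowed by the environment's protocol and by `P`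
at the current local state. -/
def IsRun (E : Env S ACTe ACT1 O PP) (P : List O → Set ACT1) (r : ℕ → S) : Prop :=
  r 0 ∈ E.initSt ∧ ∀ m, ∃ a : ACTe × ACT1,
    a.1 ∈ E.Pe (r m) ∧ a.2 ∈ P (E.locSt r m) ∧ r (m + 1) = E.tr a (r m)

/-- Satisfaction `ℐ(P,E),(r,m) ⊨ φ`. -/
def sat (E : Env S ACTe ACT1 O PP) (P : List O → Set ACT1) :
    (ℕ → S) → ℕ → Fml PP → Prop
  | _, _, .tru => True
  | r, m, .atom p => E.val (r m) p = true
  | r, m, .neg φ => ¬ E.sat P r m φ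
  | r, m, .conj φ ψ => E.sat P r m φ ∧ E.sat P r m ψ
  | r, m, .next φ => E.sat P r (m + 1) φ
  | r, m, .untl φ ψ => ∃ k, m ≤ k ∧ E.sat P r k ψ ∧ ∀ l, m ≤ l → l < k → E.sat P r l φ
  | r, m, .exis φ => ∃ r', E.IsRun P r' ∧ (∀ k, k ≤ m → r' k = r k) ∧ E.sat P r' m φ
  | r, m, .know φ => ∀ r' m', E.IsRun P r' → E.locSt r' m' = E.locSt r m → E.sat P r' m' φ

/-- `P` realizes `ψ` in `E`: `ψ` holds at time 0 of every run of ℐ(P,E). -/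
def Realizes (E : Env S ACTe ACT1 O PP) (P : List O → Set ACT1) (ψ : Fml PP) : Prop :=
  ∀ r, E.IsRun P r → E.sat P r 0 ψ

/-- `ψ` is realizable in `E`: some protocol (with nonempty action sets) realizes it. -/
def Realizable (E : Env S ACTe ACT1 O PP) (ψ : Fml PP) : Prop :=
  ∃ P : List O → Set ACT1, (∀ v, (P v).Nonempty) ∧ E.Realizes P ψ

end Env

/-- A label: a knowledge set (a set of pairs of an atom -- a Boolean valuation of formulae --
and a state) together with a set of agent-1 actions. -/
abbrev KLabel (S ACT1 PP : Type) : Type := Set ((Fml PP → Bool) × S) × Set ACT1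

/-- A labelled tree for ψ and E: a labelling of 𝒪* by labels. -/
abbrev LTree (S ACT1 O PP : Type) : Type := List O → KLabel S ACT1 PP

namespace Env
variable {S ACTe ACT1 O PP : Type}

/-- The branch of vertices determined by starting vertex `v` and state sequence `r`:
`v₀ = v`, `v_{m+1} = v_m · O₁(r (m+1))`. -/
def vtx (E : Env S ACTe ACT1 O PP) (v : List O) (r : ℕ → S) : ℕ → List O
  | 0 => v
  | m + 1 => E.vtx v r m ++ [E.obs (r (m + 1))]

/-- A run of the labelled tree `T` from vertex `v`. -/
def IsTreeRun (E : Env S ACTe ACT1 O PP) (T : LTree S ACT1 O PP) (v : List O)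
    (r : ℕ → S) : Prop :=
  (∃ X, (X, r 0) ∈ (T v).1) ∧ ∀ m, ∃ a : ACTe × ACT1,
    a.1 ∈ E.Pe (r m) ∧ a.2 ∈ (T (E.vtx v r m)).2 ∧ r (m + 1) = E.tr a (r m)

/-- The relation `𝒯,v,(r,m) ⊨* φ`. -/
def tsat (E : Env S ACTe ACT1 O PP) (T : LTree S ACT1 O PP) (v : List O) :
    (ℕ → S) → ℕ → Fml PP → Prop
  | _, _, .tru => True
  | r, m, .atom p => E.val (r m) p = true
  | r, m, .neg φ => ¬ E.tsat T v r m φ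
  | r, m, .conj φ ψ => E.tsat T v r m φ ∧ E.tsat T v r m ψ
  | r, m, .next φ => E.tsat T v r (m + 1) φ
  | r, m, .untl φ ψ => ∃ k, m ≤ k ∧ E.tsat T v r k ψ ∧ ∀ l, m ≤ l → l < k → E.tsat T v r l φ
  | r, m, .exis φ => ∃ X : Fml PP → Bool, (X, r m) ∈ (T (E.vtx v r m)).1 ∧ X φ = true
  | r, m, .know φ => ∀ X s, (X, s) ∈ (T (E.vtx v r m)).1 → X φ = true

/-- Acceptability of a labelled tree for ψ and E: the conditions Real, Init, Obs, Pred,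
Succ, ∃sound, ∃comp, Ksound, Kcomp (plus nonemptiness of the action labels, part of
being a labelled tree). -/
structure Acceptable (E : Env S ACTe ACT1 O PP) (ψ : Fml PP) (T : LTree S ACT1 O PP) :
    Prop where
  actNe : ∀ v, (T v).2.Nonempty
  real : ∀ (o : O) X s, (X, s) ∈ (T [o]).1 → X ψ = true ∧ s ∈ E.initSt
  initC : ∀ s ∈ E.initSt, ∃ X, (X, s) ∈ (T [E.obs s]).1
  obsC : ∀ (v : List O) (o : O) X s, (X, s) ∈ (T (v ++ [o])).1 → E.obs s = o
  pred : ∀ (v : List O) (o : O) X s, v ≠ [] → (X, s) ∈ (T (v ++ [o])).1 →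
    ∃ Y t, ∃ a : ACTe × ACT1, (Y, t) ∈ (T v).1 ∧ a.1 ∈ E.Pe t ∧ a.2 ∈ (T v).2 ∧ s = E.tr a t
  succ : ∀ (v : List O) X s, ∀ a : ACTe × ACT1, v ≠ [] → (X, s) ∈ (T v).1 →
    a.1 ∈ E.Pe s → a.2 ∈ (T v).2 →
    ∃ Y, (Y, E.tr a s) ∈ (T (v ++ [E.obs (E.tr a s)])).1
  exSound : ∀ (v : List O) X s φ, (Fml.exis φ) ∈ ψ.subf → (X, s) ∈ (T v).1 →
    X (Fml.exis φ) = true → ∃ Y, (Y, s) ∈ (T v).1 ∧ Y φ = true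
  exComp : ∀ (v : List O) X Y s φ, (Fml.exis φ) ∈ ψ.subf → (X, s) ∈ (T v).1 →
    (Y, s) ∈ (T v).1 → X φ = true → Y (Fml.exis φ) = true
  ksound : ∀ (v : List O) X s, v ≠ [] → (X, s) ∈ (T v).1 →
    ∃ r, E.IsTreeRun T v r ∧ r 0 = s ∧ ∀ φ ∈ ψ.subf, (E.tsat T v r 0 φ ↔ X φ = true)
  kcomp : ∀ (v : List O) r, E.IsTreeRun T v r →
    ∃ X, (X, r 0) ∈ (T v).1 ∧ ∀ φ ∈ ψ.subf, (E.tsat T v r 0 φ ↔ X φ = true)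

end Env

namespace Env
variable {S ACTe ACT1 O PP : Type}

theorem mem_subf_self (φ : Fml PP) : φ ∈ φ.subf := by
  cases φ <;> simp [Fml.subf]

theorem vtx_eq_locSt (E : Env S ACTe ACT1 O PP) (r : ℕ → S) (m : ℕ) :
    E.vtx [E.obs (r 0)] r m = E.locSt r m := by
  induction m with
  | zero => simp [vtx, locSt]
  | succ m ih => rw [vtx, ih]; simp [locSt, List.range_succ]

theorem locSt_ne_nil (E : Env S ACTe ACT1 O PP) (r : ℕ → S) (m : ℕ) :
    E.locSt r m ≠ [] := by
  simp [locSt]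

theorem locSt_succ (E : Env S ACTe ACT1 O PP) (r : ℕ → S) (m : ℕ) :
    E.locSt r (m + 1) = E.locSt r m ++ [E.obs (r (m + 1))] := by
  simp [locSt, List.range_succ]

theorem vtx_shift (E : Env S ACTe ACT1 O PP) (v : List O) (r : ℕ → S) (m k : ℕ) :
    E.vtx (E.vtx v r m) (fun i => r (m + i)) k = E.vtx v r (m + k) := by
  induction k with
  | zero => rfl
  | succ k ih => rw [vtx, ih]; rfl

theorem tsat_shift (E : Env S ACTe ACT1 O PP) (T : LTree S ACT1 O PP) (v : List O)
    (r : ℕ → S) (m : ℕ) (φ : Fml PP) : ∀ k,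
    E.tsat T (E.vtx v r m) (fun i => r (m + i)) k φ ↔ E.tsat T v r (m + k) φ := by
  induction φ with
  | tru => intro k; simp [tsat]
  | atom p => intro k; simp [tsat]
  | neg φ ih => intro k; simp [tsat, ih]
  | conj φ χ ih1 ih2 => intro k; simp [tsat, ih1, ih2]
  | next φ ih => intro k; simp only [tsat, ih]; rfl
  | untl φ χ ih1 ih2 =>
    intro k
    simp only [tsat, ih1, ih2]
    constructor
    · rintro ⟨j, h1, h2, h3⟩
      refine ⟨m + j, by omega, h2, fun l hl hl' => ?_⟩
      have := h3 (l - m) (by omega) (by omega)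
      rwa [show m + (l - m) = l by omega] at this
    · rintro ⟨j, h1, h2, h3⟩
      refine ⟨j - m, by omega, ?_, fun l hl hl' => h3 _ (by omega) (by omega)⟩
      rwa [show m + (j - m) = j by omega]
  | exis φ ih => intro k; simp only [tsat, vtx_shift]
  | know φ ih => intro k; simp only [tsat, vtx_shift]

theorem run_mem (E : Env S ACTe ACT1 O PP) {ψ : Fml PP} {T : LTree S ACT1 O PP}
    (hT : E.Acceptable ψ T) {r : ℕ → S} (hr : E.IsRun (fun v => (T v).2) r) (m : ℕ) :
    ∃ X, (X, r m) ∈ (T (E.locSt r m)).1 := by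
  induction m with
  | zero => simpa [locSt] using hT.initC _ hr.1
  | succ m ih =>
    obtain ⟨X, hX⟩ := ih
    obtain ⟨a, h1, h2, h3⟩ := hr.2 m
    rw [locSt_succ, h3]
    exact hT.succ _ X _ a (locSt_ne_nil _ _ _) hX h1 h2

theorem run_tree (E : Env S ACTe ACT1 O PP) {ψ : Fml PP} {T : LTree S ACT1 O PP}
    (hT : E.Acceptable ψ T) {r : ℕ → S} (hr : E.IsRun (fun v => (T v).2) r) (m : ℕ) :
    E.IsTreeRun T (E.locSt r m) (fun i => r (m + i)) := by
  refine ⟨run_mem E hT hr m, fun k => ?_⟩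
  rw [← vtx_eq_locSt, vtx_shift, vtx_eq_locSt]
  exact hr.2 (m + k)

theorem tsat_run (E : Env S ACTe ACT1 O PP) (T : LTree S ACT1 O PP)
    (r : ℕ → S) (m : ℕ) (φ : Fml PP) :
    E.tsat T (E.locSt r m) (fun i => r (m + i)) 0 φ ↔ E.tsat T [E.obs (r 0)] r m φ := by
  rw [← vtx_eq_locSt, tsat_shift]; rfl

theorem splice (E : Env S ACTe ACT1 O PP) {T : LTree S ACT1 O PP}
    {r : ℕ → S} (hr : E.IsRun (fun v => (T v).2) r) (m : ℕ)
    {ρ : ℕ → S} (hρ : E.IsTreeRun T (E.locSt r m) ρ) (h0 : ρ 0 = r m) :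
    ∃ r', E.IsRun (fun v => (T v).2) r' ∧ (∀ k, k ≤ m → r' k = r k) ∧
      (fun i => r' (m + i)) = ρ := by
  let r' : ℕ → S := fun k => if k ≤ m then r k else ρ (k - m)
  have hle : ∀ k, k ≤ m → r' k = r k := fun k hk => by simp [r', hk]
  have hge : ∀ i, r' (m + i) = ρ i := by
    intro i
    rcases Nat.eq_zero_or_pos i with rfl | hi
    · simp [r', h0]
    · have : ¬ (m + i ≤ m) := by omega
      simp [r', this]
  have hfun : (fun i => r' (m + i)) = ρ := funext hge
  have hloc : ∀ k, k ≤ m → E.locSt r' k = E.locSt r k := by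
    intro k hk
    unfold locSt
    apply List.map_congr_left
    intro j hj
    rw [List.mem_range] at hj
    rw [hle j (by omega)]
  refine ⟨r', ⟨?_, fun k => ?_⟩, hle, hfun⟩
  · rw [hle 0 (by omega)]; exact hr.1
  · rcases Nat.lt_or_ge k m with hk | hk
    · rw [hle k hk.le, hle (k+1) hk, hloc k hk.le]; exact hr.2 k
    · obtain ⟨i, rfl⟩ := Nat.exists_eq_add_of_le hk
      have := hρ.2 i
      rw [← hloc m le_rfl, ← hfun, ← vtx_eq_locSt, vtx_shift, vtx_eq_locSt] at this
      exact this

theorem extend_back (E : Env S ACTe ACT1 O PP) {ψ : Fml PP} {T : LTree S ACT1 O PP}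
    (hT : E.Acceptable ψ T) (v : List O) : v ≠ [] → ∀ ρ, E.IsTreeRun T v ρ →
    ∃ r m, E.IsRun (fun v => (T v).2) r ∧ E.locSt r m = v ∧ (fun i => r (m + i)) = ρ := by
  induction v using List.reverseRecOn with
  | nil => intro h; exact absurd rfl h
  | append_singleton u o ih =>
    intro _ ρ hρ
    obtain ⟨X, hX⟩ := hρ.1
    have ho := hT.obsC _ _ _ _ hX
    by_cases hu : u = []
    · subst hu
      refine ⟨ρ, 0, ⟨(hT.real o X _ hX).2, fun m => ?_⟩, by simp [locSt, ho], by simp⟩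
      have := hρ.2 m
      rw [← ho, List.nil_append, vtx_eq_locSt] at this
      exact this
    · obtain ⟨Y, t, a, hY, h1, h2, h3⟩ := hT.pred u o X _ hu hX
      let ρ' : ℕ → S := fun k => Nat.casesOn k t ρ
      have hv : ∀ k, E.vtx u ρ' (k + 1) = E.vtx (u ++ [o]) ρ k := by
        intro k
        induction k with
        | zero => simp [vtx, ρ', ho]
        | succ k ih => rw [vtx, ih]; rfl
      have hρ' : E.IsTreeRun T u ρ' := by
        refine ⟨⟨Y, hY⟩, fun k => ?_⟩
        cases k with
        | zero => exact ⟨a, h1, h2, h3⟩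
        | succ k => rw [hv]; exact hρ.2 k
      obtain ⟨r, m, hr, hl, hf⟩ := ih hu ρ' hρ'
      have hf' : ∀ i, r (m + i) = ρ' i := fun i => congrFun hf i
      refine ⟨r, m + 1, hr, ?_, ?_⟩
      · rw [locSt_succ, hl, hf' 1]; simp [ρ', ho]
      · funext i
        rw [Nat.add_assoc, hf', Nat.add_comm 1 i]

theorem sat_iff_tsat (E : Env S ACTe ACT1 O PP) {ψ : Fml PP} {T : LTree S ACT1 O PP}
    (hT : E.Acceptable ψ T) (φ : Fml PP) : φ.subf ⊆ ψ.subf →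
    ∀ r m, E.IsRun (fun v => (T v).2) r →
      (E.sat (fun v => (T v).2) r m φ ↔ E.tsat T [E.obs (r 0)] r m φ) := by
  induction φ with
  | tru => intro _ r m _; simp [sat, tsat]
  | atom p => intro _ r m _; simp [sat, tsat]
  | neg φ ih =>
    intro hs r m hr
    simp only [sat, tsat]
    rw [ih (fun x hx => hs (by simp [Fml.subf, hx])) r m hr]
  | conj φ χ ih1 ih2 =>
    intro hs r m hr
    simp only [sat, tsat]
    rw [ih1 (fun x hx => hs (by simp [Fml.subf, hx])) r m hr,
      ih2 (fun x hx => hs (by simp [Fml.subf, hx])) r m hr]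
  | next φ ih =>
    intro hs r m hr
    simp only [sat, tsat]
    rw [ih (fun x hx => hs (by simp [Fml.subf, hx])) r _ hr]
  | untl φ χ ih1 ih2 =>
    intro hs r m hr
    have e1 := fun k => ih1 (fun x hx => hs (by simp [Fml.subf, hx])) r k hr
    have e2 := fun k => ih2 (fun x hx => hs (by simp [Fml.subf, hx])) r k hr
    simp only [sat, tsat, e1, e2]
  | exis φ ih =>
    intro hs r m hr
    have hs' : φ.subf ⊆ ψ.subf := fun x hx => hs (by simp [Fml.subf, hx])
    have hφ : φ ∈ ψ.subf := hs' (mem_subf_self φ)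
    simp only [sat, tsat, vtx_eq_locSt]
    constructor
    · rintro ⟨r', hr', hag, h⟩
      rw [ih hs' r' m hr', ← tsat_run] at h
      obtain ⟨X, hX, hXs⟩ := hT.kcomp _ _ (run_tree E hT hr' m)
      have hloc : E.locSt r' m = E.locSt r m := by
        unfold locSt
        apply List.map_congr_left
        intro j hj
        rw [List.mem_range] at hj
        rw [hag j (by omega)]
      refine ⟨X, ?_, (hXs φ hφ).1 h⟩
      rw [← hloc, ← hag m le_rfl]; exact hX
    · rintro ⟨X, hX, hXφ⟩
      obtain ⟨ρ, hρ, h0, hsat⟩ := hT.ksound _ X _ (locSt_ne_nil E r m) hX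
      obtain ⟨r', hr', hag, hf⟩ := splice E hr m hρ h0
      refine ⟨r', hr', hag, ?_⟩
      have hloc : E.locSt r' m = E.locSt r m := by
        unfold locSt
        apply List.map_congr_left
        intro j hj
        rw [List.mem_range] at hj
        rw [hag j (by omega)]
      rw [ih hs' r' m hr', ← tsat_run, hloc, hf]
      exact (hsat φ hφ).2 hXφ
  | know φ ih =>
    intro hs r m hr
    have hs' : φ.subf ⊆ ψ.subf := fun x hx => hs (by simp [Fml.subf, hx])
    have hφ : φ ∈ ψ.subf := hs' (mem_subf_self φ)
    simp only [sat, tsat, vtx_eq_locSt]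
    constructor
    · intro h X s hX
      obtain ⟨ρ, hρ, h0, hsat⟩ := hT.ksound _ X _ (locSt_ne_nil E r m) hX
      obtain ⟨r', m', hr', hl, hf⟩ := extend_back E hT _ (locSt_ne_nil E r m) ρ hρ
      have := h r' m' hr' hl
      rw [ih hs' r' m' hr', ← tsat_run, hl, hf] at this
      exact (hsat φ hφ).1 this
    · intro h r' m' hr' hl
      rw [ih hs' r' m' hr', ← tsat_run]
      obtain ⟨X, hX, hXs⟩ := hT.kcomp _ _ (run_tree E hT hr' m')
      refine (hXs φ hφ).2 (h X (r' (m' + 0)) ?_)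
      rw [← hl]; exact hX

end Env

/-- **Theorem.** If 𝒯 is an acceptable labelled tree for ψ and E, then the protocol
derived from 𝒯 (assigning to each vertex the action component of its label) realizes
ψ in E. -/
theorem stmt1 {S ACTe ACT1 O PP : Type} [Fintype S] [Fintype ACTe] [Fintype ACT1]
    [Fintype O] (E : Env S ACTe ACT1 O PP) (ψ : Fml PP) (T : LTree S ACT1 O PP)
    (hT : E.Acceptable ψ T) :
    E.Realizes (fun v => (T v).2) ψ := by
  intro r hr
  rw [Env.sat_iff_tsat E hT ψ (fun x hx => hx) r 0 hr, ← Env.tsat_run]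
  obtain ⟨X, hX, hXs⟩ := hT.kcomp _ _ (Env.run_tree E hT hr 0)
  refine (hXs ψ (Env.mem_subf_self ψ)).2 ?_
  exact (hT.real (E.obs (r 0)) X _ hX).1
end

section
/- In the toggle environment with initial states I_e = {⟨1,0⟩, ⟨1,1⟩}, let A be the single-state automaton (Q = {q}, μ(q,o) = q, α(q) = {T}) representing the always-toggle protocol P_A. Although P_A realizes □(K_1 toggle-on ∨ K_1 ¬toggle-on), for every run r of ℐ(P_A,E) the formula □(K_1^A toggle-on ∨ K_1^A ¬toggle-on) is false at (r,0), i.e., ℐ(P_A,E),(r,0) ⊭ □(K_1^A toggle-on ∨ K_1^A ¬toggle-on). -/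
/-! Multi-agent framework: formulas of the logic of knowledge and branching time with
both perfect-recall knowledge operators K_i and automaton-based operators K_i^A,
environments for n agents, runs, joint protocols, protocol automata, satisfaction. -/

/-- Formulae: atomic propositions, ¬, ∧, ○, U, ∃, K_i and K_i^A. -/
inductive MFml (n : ℕ) (PP : Type) : Type
  | tru : MFml n PP
  | atom : PP → MFml n PP
  | neg : MFml n PP → MFml n PP
  | conj : MFml n PP → MFml n PP → MFml n PP
  | next : MFml n PP → MFml n PP
  | untl : MFml n PP → MFml n PP → MFml n PP
  | exis : MFml n PP → MFml n PP
  | know : Fin n → MFml n PP → MFml n PP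
  | knowA : Fin n → MFml n PP → MFml n PP
  deriving DecidableEq

namespace MFml
variable {n : ℕ} {PP PP' : Type}

/-- The list of subformulae. -/
def subf : MFml n PP → List (MFml n PP)
  | tru => [tru]
  | atom p => [atom p]
  | neg φ => neg φ :: φ.subf
  | conj φ ψ => conj φ ψ :: (φ.subf ++ ψ.subf)
  | next φ => next φ :: φ.subf
  | untl φ ψ => untl φ ψ :: (φ.subf ++ ψ.subf)
  | exis φ => exis φ :: φ.subf
  | know i φ => know i φ :: φ.subf
  | knowA i φ => knowA i φ :: φ.subf

/-- The formula contains no automaton-knowledge operator K_i^A, i.e. it is a formula of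
the logic of knowledge and branching time. -/
def noA : MFml n PP → Prop
  | tru => True
  | atom _ => True
  | neg φ => φ.noA
  | conj φ ψ => φ.noA ∧ ψ.noA
  | next φ => φ.noA
  | untl φ ψ => φ.noA ∧ ψ.noA
  | exis φ => φ.noA
  | know _ φ => φ.noA
  | knowA _ _ => False

/-- Renaming of atomic propositions. -/
def pmap (f : PP → PP') : MFml n PP → MFml n PP'
  | tru => tru
  | atom p => atom (f p)
  | neg φ => neg (φ.pmap f)
  | conj φ ψ => conj (φ.pmap f) (ψ.pmap f)
  | next φ => next (φ.pmap f)
  | untl φ ψ => untl (φ.pmap f) (ψ.pmap f)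
  | exis φ => exis (φ.pmap f)
  | know i φ => know i (φ.pmap f)
  | knowA i φ => knowA i (φ.pmap f)

/-- Implication φ ⇒ ψ, i.e. ¬(φ ∧ ¬ψ). -/
def imp (φ ψ : MFml n PP) : MFml n PP := neg (conj φ (neg ψ))

/-- Equivalence φ ≡ ψ. -/
def iff' (φ ψ : MFml n PP) : MFml n PP := conj (imp φ ψ) (imp ψ φ)

/-- Disjunction φ ∨ ψ, i.e. ¬(¬φ ∧ ¬ψ). -/
def disj (φ ψ : MFml n PP) : MFml n PP := neg (conj (neg φ) (neg ψ))

/-- □φ, i.e. ¬(true U ¬φ). -/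
def box (φ : MFml n PP) : MFml n PP := neg (untl tru (neg φ))

/-- ∀φ, i.e. ¬∃¬φ. -/
def fall (φ : MFml n PP) : MFml n PP := neg (exis (neg φ))

/-- Finite conjunction. -/
def bigConj (l : List (MFml n PP)) : MFml n PP := l.foldr conj tru

end MFml

/-- An automaton representing an agent's protocol: protocol states, initial state,
transition function on observations, and action function. -/
structure PAut (O A : Type) : Type 1 where
  Q : Type
  q0 : Q
  mu : Q → O → Q
  act : Q → Set A

namespace PAut
variable {O A : Type}

/-- The state `A(σ)` reached after reading the input sequence σ. -/
def run (M : PAut O A) (σ : List O) : M.Q := σ.foldl M.mu M.q0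

/-- The protocol `P_A` represented by the automaton. -/
def prot (M : PAut O A) (σ : List O) : Set A := M.act (M.run σ)

end PAut

/-- The trivial one-state automaton (used where the automaton component of the
semantics is irrelevant). -/
def unitAut (O A : Type) : PAut O A :=
  ⟨PUnit, PUnit.unit, fun _ _ => PUnit.unit, fun _ => Set.univ⟩

/-- A (finite, when the state type is finite) interpreted environment for n agents. -/
structure MEnv (n : ℕ) (S ACTe : Type) (ACT : Fin n → Type) (O PP : Type) where
  initSt : Set S
  Pe : S → Set ACTe
  Pe_ne : ∀ s, (Pe s).Nonempty
  tr : ACTe × ((i : Fin n) → ACT i) → S → S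
  obs : Fin n → S → O
  val : S → PP → Bool

namespace MEnv
variable {n : ℕ} {S ACTe : Type} {ACT : Fin n → Type} {O PP : Type}

/-- Synchronous perfect-recall local state `r_i(m) = O_i(r 0) … O_i(r m)`. -/
def locSt (E : MEnv n S ACTe ACT O PP) (i : Fin n) (r : ℕ → S) (m : ℕ) : List O :=
  (List.range (m + 1)).map fun k => E.obs i (r k)

/-- The runs of the system generated by the joint protocol `P` in `E`. -/
def IsRun (E : MEnv n S ACTe ACT O PP) (P : (i : Fin n) → List O → Set (ACT i))
    (r : ℕ → S) : Prop :=
  r 0 ∈ E.initSt ∧ ∀ m, ∃ a : ACTe × ((i : Fin n) → ACT i),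
    a.1 ∈ E.Pe (r m) ∧ (∀ i, a.2 i ∈ P i (E.locSt i r m)) ∧ r (m + 1) = E.tr a (r m)

/-- Satisfaction `ℐ(P,E),(r,m) ⊨ φ`; the operators `K_i^A` are interpreted via the
indistinguishability relation ≈_i^A induced by the automata `Au`. -/
def msat (E : MEnv n S ACTe ACT O PP) (P : (i : Fin n) → List O → Set (ACT i))
    (Au : (i : Fin n) → PAut O (ACT i)) : (ℕ → S) → ℕ → MFml n PP → Prop
  | _, _, .tru => True
  | r, m, .atom p => E.val (r m) p = true
  | r, m, .neg φ => ¬ E.msat P Au r m φ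
  | r, m, .conj φ ψ => E.msat P Au r m φ ∧ E.msat P Au r m ψ
  | r, m, .next φ => E.msat P Au r (m + 1) φ
  | r, m, .untl φ ψ =>
      ∃ k, m ≤ k ∧ E.msat P Au r k ψ ∧ ∀ l, m ≤ l → l < k → E.msat P Au r l φ
  | r, m, .exis φ => ∃ r', E.IsRun P r' ∧ (∀ k, k ≤ m → r' k = r k) ∧ E.msat P Au r' m φ
  | r, m, .know i φ => ∀ r' m', E.IsRun P r' →
      E.locSt i r' m' = E.locSt i r m → E.msat P Au r' m' φ
  | r, m, .knowA i φ => ∀ r' m', E.IsRun P r' →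
      (Au i).run (E.locSt i r' m') = (Au i).run (E.locSt i r m) → E.msat P Au r' m' φ

/-- The joint protocol `P` realizes ψ in `E`. -/
def MRealizes (E : MEnv n S ACTe ACT O PP) (P : (i : Fin n) → List O → Set (ACT i))
    (Au : (i : Fin n) → PAut O (ACT i)) (ψ : MFml n PP) : Prop :=
  ∀ r, E.IsRun P r → E.msat P Au r 0 ψ

end MEnv

/-- The joint protocol `P_A` represented by a tuple of automata. -/
def autProt {n : ℕ} {O : Type} {ACT : Fin n → Type} (Au : (i : Fin n) → PAut O (ACT i)) :
    (i : Fin n) → List O → Set (ACT i) := fun i => (Au i).prot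

/-! The timed toggle switch environment of Example 1. -/

/-- Agent 1's actions: toggle (T) and the null action (Λ). -/
inductive TogAct : Type
  | tog : TogAct
  | nop : TogAct
  deriving DecidableEq

/-- States ⟨t,l⟩ with t the toggle position and l the light, subject to l ≤ t
(the light can only be on when the toggle is on). -/
abbrev TogSt : Type := {p : Bool × Bool // p.2 ≤ p.1}

/-- Transition function: the toggle flips if the agent toggles or (being on) the
environment times it out; the light is on iff the toggle is on and the environment
switches it on. -/
def togTr (a : (Bool × Bool) × (Fin 1 → TogAct)) (s : TogSt) : TogSt :=
  let t := s.val.1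
  let t' := if a.2 0 = TogAct.tog ∨ (t = true ∧ a.1.1 = true) then !t else t
  ⟨(t', t' && a.1.2), by cases t' <;> cases a.1.2 <;> simp⟩

/-- The toggle environment, with a parameter for the set of initial states: one agent,
environment actions (u,v) (timeout, light-on), observation = the light, and the single
atomic proposition toggle-on. -/
def togEnv (I : Set TogSt) : MEnv 1 TogSt (Bool × Bool) (fun _ => TogAct) Bool Unit where
  initSt := I
  Pe := fun _ => Set.univ
  Pe_ne := fun _ => ⟨(true, true), Set.mem_univ _⟩
  tr := togTr
  obs := fun _ s => s.val.2
  val := fun s _ => s.val.1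

/-- The atomic proposition toggle-on. -/
def tOn : MFml 1 Unit := MFml.atom ()

/-- The specification □(K₁ toggle-on ∨ K₁ ¬toggle-on). -/
def togSpec : MFml 1 Unit :=
  MFml.box (MFml.disj (MFml.know 0 tOn) (MFml.know 0 (MFml.neg tOn)))

/-- The single-state automaton representing the always-toggle protocol. -/
def togAut : PAut Bool TogAct :=
  ⟨PUnit, PUnit.unit, fun _ _ => PUnit.unit, fun _ => {TogAct.tog}⟩

/-- Along every run of the always-toggle protocol the toggle is on exactly at even times. -/
theorem tog_parity (r : ℕ → TogSt)
    (h : (togEnv {s | s.val.1 = true}).IsRun (autProt fun _ => togAut) r) (m : ℕ) :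
    (r m).val.1 = decide (m % 2 = 0) := by
  induction m with
  | zero => simpa [togEnv] using h.1
  | succ k ih =>
    obtain ⟨a, -, ha, he⟩ := h.2 k
    have h0 : a.2 0 = TogAct.tog := ha 0
    rw [he]
    simp only [togEnv, togTr, h0, true_or, if_true, ih]
    rcases Nat.mod_two_eq_zero_or_one k with hk | hk <;> simp [Nat.add_mod, hk]

/-- **Example.** Although the always-toggle protocol (represented by the single-state
automaton A) realizes □(K₁ toggle-on ∨ K₁ ¬toggle-on) in the toggle environment with
initial states {⟨1,0⟩,⟨1,1⟩}, the formula □(K₁^A toggle-on ∨ K₁^A ¬toggle-on) is false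
at time 0 of every run of the generated system. -/
theorem stmt18 :
    (togEnv {s | s.val.1 = true}).MRealizes (autProt fun _ => togAut)
      (fun _ => togAut) togSpec ∧
    ∀ r : ℕ → TogSt, (togEnv {s | s.val.1 = true}).IsRun (autProt fun _ => togAut) r →
      ¬ (togEnv {s | s.val.1 = true}).msat (autProt fun _ => togAut) (fun _ => togAut)
          r 0 (MFml.box (MFml.disj (MFml.knowA 0 tOn)
            (MFml.knowA 0 (MFml.neg tOn)))) := by
  constructor
  · intro r hr
    simp only [togSpec, MFml.box, MFml.disj, tOn, MEnv.msat]
    rintro ⟨k, -, h, -⟩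
    apply h
    rintro ⟨h1, h2⟩
    have key : ∀ r' m', (togEnv {s | s.val.1 = true}).IsRun (autProt fun _ => togAut) r' →
        (togEnv {s | s.val.1 = true}).locSt 0 r' m' =
          (togEnv {s | s.val.1 = true}).locSt 0 r k → (r' m').val.1 = (r k).val.1 := by
      intro r' m' hr' hl
      have hm : m' = k := by
        have := congrArg List.length hl
        simpa [MEnv.locSt] using this
      rw [tog_parity r' hr', tog_parity r hr, hm]
    cases hv : (r k).val.1
    · apply h2
      intro r' m' hr' hl hc
      have hc' : (r' m').val.1 = true := hc
      rw [key r' m' hr' hl, hv] at hc'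
      exact absurd hc' (by simp)
    · apply h1
      intro r' m' hr' hl
      exact (key r' m' hr' hl).trans hv
  · intro r hr
    simp only [MFml.box, MFml.disj, tOn, MEnv.msat]
    intro h
    apply h
    refine ⟨0, le_rfl, ?_, fun _ _ _ => trivial⟩
    intro hn
    apply hn
    constructor
    · intro hk
      have h1 : (r 1).val.1 = true := hk r 1 hr rfl
      rw [tog_parity r hr] at h1
      simp at h1
    · intro hk
      refine hk r 0 hr rfl ?_
      change (r 0).val.1 = true
      rw [tog_parity r hr]
      simp
end
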